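/- arXiv:1003.2240 — 2 statements merged into one kernel-verified Lean document; each statement's English description precedes it below -/
import Mathlib

section
/- Let g be smooth on Ω and let F = (z₁, z₂, z₃) ∈ C³(Ω, ℝ³) satisfy ∂_iF · ∂_jF = g_ij on Ω for i,j = 1,2 (Euclidean dot product in ℝ³). Then each component z_α (α = 1,2,3) satisfies Darboux's equation det(∇_ij z_α) = K·(det g)·(1 − |∇_g z_α|²) on Ω, where K is the Gaussian curvature of g. -/
open Real Set Filter Topology

noncomputable section

/-- Partial derivative of `f : ℝ × ℝ → ℝ` in coordinate direction `i`. -/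
def pd (i : Fin 2) (f : ℝ × ℝ → ℝ) (p : ℝ × ℝ) : ℝ :=
  fderiv ℝ f p (if i = 0 then (1, 0) else (0, 1))

/-- The metric components as a 2×2 symmetric matrix of functions. -/
def gmat (g11 g12 g22 : ℝ × ℝ → ℝ) (i j : Fin 2) : ℝ × ℝ → ℝ :=
  if i = 0 then (if j = 0 then g11 else g12) else (if j = 0 then g12 else g22)

/-- The determinant of the metric. -/
def gdet (g11 g12 g22 : ℝ × ℝ → ℝ) (p : ℝ × ℝ) : ℝ :=
  g11 p * g22 p - g12 p ^ 2

/-- Components of the inverse metric. -/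
def ginv (g11 g12 g22 : ℝ × ℝ → ℝ) (i j : Fin 2) (p : ℝ × ℝ) : ℝ :=
  (if i = 0 then (if j = 0 then g22 p else -g12 p)
   else (if j = 0 then -g12 p else g11 p)) / gdet g11 g12 g22 p

/-- Christoffel symbols Γˡ_{ij}. -/
def Chr (g11 g12 g22 : ℝ × ℝ → ℝ) (l i j : Fin 2) (p : ℝ × ℝ) : ℝ :=
  (1 / 2) * ∑ m : Fin 2, ginv g11 g12 g22 l m p *
    (pd i (gmat g11 g12 g22 j m) p + pd j (gmat g11 g12 g22 i m) p
      - pd m (gmat g11 g12 g22 i j) p)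

/-- Second covariant derivatives ∇_{ij} z. -/
def cov2 (g11 g12 g22 z : ℝ × ℝ → ℝ) (i j : Fin 2) (p : ℝ × ℝ) : ℝ :=
  pd i (pd j z) p - ∑ l : Fin 2, Chr g11 g12 g22 l i j p * pd l z p

/-- |∇_g z|². -/
def gradSq (g11 g12 g22 z : ℝ × ℝ → ℝ) (p : ℝ × ℝ) : ℝ :=
  ∑ i : Fin 2, ∑ j : Fin 2, ginv g11 g12 g22 i j p * pd i z p * pd j z p

/-- The Gaussian curvature of the metric g. -/
def GaussK (g11 g12 g22 : ℝ × ℝ → ℝ) (p : ℝ × ℝ) : ℝ :=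
  (1 / gdet g11 g12 g22 p) * ∑ i : Fin 2, gmat g11 g12 g22 0 i p *
    (pd 0 (Chr g11 g12 g22 i 1 1) p - pd 1 (Chr g11 g12 g22 i 0 1) p
      + ∑ j : Fin 2, (Chr g11 g12 g22 j 1 1 p * Chr g11 g12 g22 i j 0 p
          - Chr g11 g12 g22 j 0 1 p * Chr g11 g12 g22 i j 1 p))

/-- Darboux's equation at a point p. -/
def DarbouxEq (g11 g12 g22 z : ℝ × ℝ → ℝ) (p : ℝ × ℝ) : Prop :=
  cov2 g11 g12 g22 z 0 0 p * cov2 g11 g12 g22 z 1 1 p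
      - cov2 g11 g12 g22 z 0 1 p * cov2 g11 g12 g22 z 1 0 p
    = GaussK g11 g12 g22 p * gdet g11 g12 g22 p * (1 - gradSq g11 g12 g22 z p)

/-- A smooth Riemannian metric on Ω. -/
def IsMetricOn (g11 g12 g22 : ℝ × ℝ → ℝ) (Ω : Set (ℝ × ℝ)) : Prop :=
  ContDiffOn ℝ (⊤ : ℕ∞) g11 Ω ∧ ContDiffOn ℝ (⊤ : ℕ∞) g12 Ω ∧ ContDiffOn ℝ (⊤ : ℕ∞) g22 Ω ∧
  ∀ p ∈ Ω, 0 < g11 p ∧ 0 < gdet g11 g12 g22 p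

/-- The centers q_n = (1/n, 0). -/
def qpt (n : ℕ) : ℝ × ℝ := (1 / (n : ℝ), 0)

/-- Half-width of the square Xⁿ (whose width is 1/(2n(n+1))). -/
def halfw (n : ℕ) : ℝ := 1 / (4 * (n : ℝ) * ((n : ℝ) + 1))

/-- The open axis-parallel square Xⁿ centered at q_n of width 1/(2n(n+1)). -/
def sqX (n : ℕ) : Set (ℝ × ℝ) :=
  {p | |p.1 - 1 / (n : ℝ)| < halfw n ∧ |p.2| < halfw n}

/-- The square X = (-1,1) × (-1,1). -/
def Xset : Set (ℝ × ℝ) := Ioo (-1 : ℝ) 1 ×ˢ Ioo (-1 : ℝ) 1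

/-- φ is C^∞ on the closure of X, vanishes to infinite order on ∂X, and has a sign on X. -/
def PhiAdmissible (φ : ℝ × ℝ → ℝ) : Prop :=
  ContDiffOn ℝ (⊤ : ℕ∞) φ (closure Xset) ∧
  (∀ k : ℕ, ∀ p ∈ frontier Xset, iteratedFDerivWithin ℝ k φ (closure Xset) p = 0) ∧
  ((∀ p ∈ Xset, 0 < φ p) ∨ (∀ p ∈ Xset, φ p < 0))

/-- K is obtained from φ and the sequence γ by the construction of the paper. -/
def Kconstr (φ : ℝ × ℝ → ℝ) (γ : ℕ → ℝ) (K : ℝ × ℝ → ℝ) : Prop :=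
  (∀ n : ℕ, 1 ≤ n → ∀ q ∈ closure (sqX n),
      K q = γ n * φ ((4 * (n : ℝ) * ((n : ℝ) + 1)) • (q - qpt n))) ∧
  (∀ q : ℝ × ℝ, q ∉ ⋃ n ∈ {m : ℕ | 1 ≤ m}, sqX n → K q = 0)

/-- Right vertical side +v_n of ∂Xⁿ. -/
def vSideR (n : ℕ) : Set (ℝ × ℝ) :=
  {p | p.1 = 1 / (n : ℝ) + halfw n ∧ |p.2| ≤ halfw n}

/-- Left vertical side -v_n of ∂Xⁿ. -/
def vSideL (n : ℕ) : Set (ℝ × ℝ) :=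
  {p | p.1 = 1 / (n : ℝ) - halfw n ∧ |p.2| ≤ halfw n}

/-- Top horizontal side +h_n of ∂Xⁿ. -/
def hSideT (n : ℕ) : Set (ℝ × ℝ) :=
  {p | p.2 = halfw n ∧ |p.1 - 1 / (n : ℝ)| ≤ halfw n}

/-- Bottom horizontal side -h_n of ∂Xⁿ. -/
def hSideB (n : ℕ) : Set (ℝ × ℝ) :=
  {p | p.2 = -halfw n ∧ |p.1 - 1 / (n : ℝ)| ≤ halfw n}

/-- At the point p there is a C³ change of coordinates Φ(x,y) = (x - p¹, s(x,y)) on a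
neighborhood U ⊆ Ω of p, a C² function u and a positive continuous f on Φ(U), solving
∂_tt u + (K ∘ Φ⁻¹) ∂_ss u = (K ∘ Φ⁻¹) f on Φ(U). -/
def GoodChartAt (K : ℝ × ℝ → ℝ) (Ω : Set (ℝ × ℝ)) (p : ℝ × ℝ) : Prop :=
  ∃ (U : Set (ℝ × ℝ)) (s : ℝ × ℝ → ℝ) (Ψ : ℝ × ℝ → ℝ × ℝ) (u f : ℝ × ℝ → ℝ),
    IsOpen U ∧ p ∈ U ∧ U ⊆ Ω ∧ ContDiffOn ℝ 3 s U ∧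
    IsOpen ((fun q => (q.1 - p.1, s q)) '' U) ∧
    ContDiffOn ℝ 3 Ψ ((fun q => (q.1 - p.1, s q)) '' U) ∧
    (∀ q ∈ U, Ψ (q.1 - p.1, s q) = q) ∧
    (∀ w ∈ (fun q => (q.1 - p.1, s q)) '' U, ((Ψ w).1 - p.1, s (Ψ w)) = w) ∧
    ContDiffOn ℝ 2 u ((fun q => (q.1 - p.1, s q)) '' U) ∧
    ContinuousOn f ((fun q => (q.1 - p.1, s q)) '' U) ∧
    (∀ w ∈ (fun q => (q.1 - p.1, s q)) '' U, 0 < f w) ∧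
    (∀ w ∈ (fun q => (q.1 - p.1, s q)) '' U,
      pd 0 (pd 0 u) w + K (Ψ w) * pd 1 (pd 1 u) w = K (Ψ w) * f w)


section PartialDerivatives

theorem ContDiffOn.pd_of_isOpen {Ω : Set (ℝ × ℝ)} (hΩ : IsOpen Ω) {f : ℝ × ℝ → ℝ}
    {m n : WithTop ℕ∞} (hf : ContDiffOn ℝ n f Ω) (hmn : m + 1 ≤ n) (i : Fin 2) :
    ContDiffOn ℝ m (pd i f) Ω :=
  (hf.fderiv_of_isOpen hΩ hmn).clm_apply contDiffOn_const

theorem pd_congr_of_isOpen {Ω : Set (ℝ × ℝ)} (hΩ : IsOpen Ω) {f h : ℝ × ℝ → ℝ}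
    (hfh : ∀ q ∈ Ω, f q = h q) (i : Fin 2) {p : ℝ × ℝ} (hp : p ∈ Ω) : pd i f p = pd i h p := by
  have : f =ᶠ[𝓝 p] h := Filter.eventuallyEq_of_mem (hΩ.mem_nhds hp) hfh
  simp only [pd, this.fderiv_eq]

theorem pd_add {f h : ℝ × ℝ → ℝ} {p : ℝ × ℝ} (hf : DifferentiableAt ℝ f p)
    (hh : DifferentiableAt ℝ h p) (i : Fin 2) :
    pd i (fun q => f q + h q) p = pd i f p + pd i h p := by
  simp only [pd, fderiv_fun_add hf hh, add_apply]

theorem pd_mul {f h : ℝ × ℝ → ℝ} {p : ℝ × ℝ} (hf : DifferentiableAt ℝ f p)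
    (hh : DifferentiableAt ℝ h p) (i : Fin 2) :
    pd i (fun q => f q * h q) p = pd i f p * h p + f p * pd i h p := by
  simp only [pd, fderiv_fun_mul hf hh, add_apply,
    smul_apply, smul_eq_mul]
  ring

theorem pd_comm {f : ℝ × ℝ → ℝ} {p : ℝ × ℝ} (hf : ContDiffAt ℝ 2 f p) (i j : Fin 2) :
    pd i (pd j f) p = pd j (pd i f) p := by
  have hd : DifferentiableAt ℝ (fderiv ℝ f) p :=
    (hf.fderiv_right (m := 1) (by norm_num)).differentiableAt (by norm_num)
  have key (k l : Fin 2) : pd k (pd l f) p =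
      fderiv ℝ (fderiv ℝ f) p (if k = 0 then (1, 0) else (0, 1))
        (if l = 0 then (1, 0) else (0, 1)) := by
    change fderiv ℝ (fun q => fderiv ℝ f q _) p _ = _
    rw [fderiv_clm_apply hd (differentiableAt_const _)]
    simp
  rw [key, key]
  exact (hf.isSymmSndFDerivAt (by simp)).eq _ _

/-- The product rule for the dot product of two vector fields with values in `ℝ³`. -/
theorem pd_dot {f₁ f₂ f₃ h₁ h₂ h₃ : ℝ × ℝ → ℝ} {p : ℝ × ℝ}
    (hf₁ : DifferentiableAt ℝ f₁ p) (hf₂ : DifferentiableAt ℝ f₂ p)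
    (hf₃ : DifferentiableAt ℝ f₃ p) (hh₁ : DifferentiableAt ℝ h₁ p)
    (hh₂ : DifferentiableAt ℝ h₂ p) (hh₃ : DifferentiableAt ℝ h₃ p) (i : Fin 2) :
    pd i (fun q => f₁ q * h₁ q + f₂ q * h₂ q + f₃ q * h₃ q) p =
      pd i f₁ p * h₁ p + pd i f₂ p * h₂ p + pd i f₃ p * h₃ p +
        (f₁ p * pd i h₁ p + f₂ p * pd i h₂ p + f₃ p * pd i h₃ p) := by
  rw [pd_add ((hf₁.fun_mul hh₁).fun_add (hf₂.fun_mul hh₂)) (hf₃.fun_mul hh₃),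
    pd_add (hf₁.fun_mul hh₁) (hf₂.fun_mul hh₂),
    pd_mul hf₁ hh₁, pd_mul hf₂ hh₂, pd_mul hf₃ hh₃]
  ring

end PartialDerivatives

/-- Lowering the upper index of the Christoffel symbols gives the Christoffel symbols of the first
kind. -/
theorem sum_gmat_mul_Chr {g11 g12 g22 : ℝ × ℝ → ℝ} {p : ℝ × ℝ} (hd : gdet g11 g12 g22 p ≠ 0)
    (m i j : Fin 2) :
    ∑ l : Fin 2, gmat g11 g12 g22 m l p * Chr g11 g12 g22 l i j p =
      (1 / 2) * (pd i (gmat g11 g12 g22 j m) p + pd j (gmat g11 g12 g22 i m) p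
        - pd m (gmat g11 g12 g22 i j) p) := by
  have hinv (k : Fin 2) : ∑ l : Fin 2, gmat g11 g12 g22 m l p * ginv g11 g12 g22 l k p =
      if m = k then 1 else 0 := by
    fin_cases m <;> fin_cases k <;> simp [gmat, ginv] <;> field_simp <;> simp [gdet] <;> ring
  have h0 := hinv 0
  have h1 := hinv 1
  simp only [Fin.sum_univ_two] at h0 h1
  simp only [Chr, Fin.sum_univ_two]
  generalize ginv g11 g12 g22 0 0 p = a at *
  generalize ginv g11 g12 g22 0 1 p = b at *
  generalize ginv g11 g12 g22 1 0 p = c at *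
  generalize ginv g11 g12 g22 1 1 p = d at *
  trans (1 / 2) * ((if m = 0 then 1 else 0) * (pd i (gmat g11 g12 g22 j 0) p +
      pd j (gmat g11 g12 g22 i 0) p - pd 0 (gmat g11 g12 g22 i j) p) +
      (if m = 1 then 1 else 0) * (pd i (gmat g11 g12 g22 j 1) p +
      pd j (gmat g11 g12 g22 i 1) p - pd 1 (gmat g11 g12 g22 i j) p))
  · rw [← h0, ← h1]
    ring
  · fin_cases m <;> simp

/-- A vector orthogonal to two linearly independent vectors of `ℝ³` is a multiple of their cross
product. -/
theorem exists_eq_mul_cross {a₁ a₂ a₃ b₁ b₂ b₃ u₁ u₂ u₃ : ℝ}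
    (hd : (a₁ * a₁ + a₂ * a₂ + a₃ * a₃) * (b₁ * b₁ + b₂ * b₂ + b₃ * b₃)
      - (a₁ * b₁ + a₂ * b₂ + a₃ * b₃) ^ 2 ≠ 0)
    (ha : u₁ * a₁ + u₂ * a₂ + u₃ * a₃ = 0) (hb : u₁ * b₁ + u₂ * b₂ + u₃ * b₃ = 0) :
    ∃ t, u₁ = t * (a₂ * b₃ - a₃ * b₂) ∧ u₂ = t * (a₃ * b₁ - a₁ * b₃) ∧
      u₃ = t * (a₁ * b₂ - a₂ * b₁) := by
  set D := (a₁ * a₁ + a₂ * a₂ + a₃ * a₃) * (b₁ * b₁ + b₂ * b₂ + b₃ * b₃)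
      - (a₁ * b₁ + a₂ * b₂ + a₃ * b₃) ^ 2 with hD
  refine ⟨(u₁ * (a₂ * b₃ - a₃ * b₂) + u₂ * (a₃ * b₁ - a₁ * b₃) + u₃ * (a₁ * b₂ - a₂ * b₁)) / D,
    ?_, ?_, ?_⟩ <;> field_simp
  all_goals rw [hD]
  · grind
  · grind
  · grind

/-- The algebraic form of the Gauss equation for one component: `u, v, w` are the values of the
second fundamental form on a pair of tangent vectors `a, b`. -/
theorem det_fst_eq_of_orthogonal {a₁ a₂ a₃ b₁ b₂ b₃ u₁ u₂ u₃ v₁ v₂ v₃ w₁ w₂ w₃ E F G : ℝ}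
    (hE : a₁ * a₁ + a₂ * a₂ + a₃ * a₃ = E) (hF : a₁ * b₁ + a₂ * b₂ + a₃ * b₃ = F)
    (hG : b₁ * b₁ + b₂ * b₂ + b₃ * b₃ = G) (hd : E * G - F ^ 2 ≠ 0)
    (hua : u₁ * a₁ + u₂ * a₂ + u₃ * a₃ = 0) (hub : u₁ * b₁ + u₂ * b₂ + u₃ * b₃ = 0)
    (hva : v₁ * a₁ + v₂ * a₂ + v₃ * a₃ = 0) (hvb : v₁ * b₁ + v₂ * b₂ + v₃ * b₃ = 0)
    (hwa : w₁ * a₁ + w₂ * a₂ + w₃ * a₃ = 0) (hwb : w₁ * b₁ + w₂ * b₂ + w₃ * b₃ = 0) :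
    u₁ * w₁ - v₁ * v₁ = ((u₁ * w₁ + u₂ * w₂ + u₃ * w₃) - (v₁ * v₁ + v₂ * v₂ + v₃ * v₃)) *
      (1 - (G * a₁ * a₁ - 2 * F * a₁ * b₁ + E * b₁ * b₁) / (E * G - F ^ 2)) := by
  subst hE hF hG
  obtain ⟨r, rfl, rfl, rfl⟩ := exists_eq_mul_cross hd hua hub
  obtain ⟨s, rfl, rfl, rfl⟩ := exists_eq_mul_cross hd hva hvb
  obtain ⟨t, rfl, rfl, rfl⟩ := exists_eq_mul_cross hd hwa hwb
  rw [one_sub_div hd, mul_div_assoc', eq_div_iff hd]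
  ring

section Embedding

variable {Ω : Set (ℝ × ℝ)} {g11 g12 g22 z₁ z₂ z₃ : ℝ × ℝ → ℝ}

/-- For an isometric embedding, the Christoffel symbols of the first kind are the tangential
components of the second derivatives. -/
theorem sum_gmat_mul_Chr_of_isometric (hΩ : IsOpen Ω)
    (hd : ∀ p ∈ Ω, gdet g11 g12 g22 p ≠ 0)
    (hz₁ : ContDiffOn ℝ 3 z₁ Ω) (hz₂ : ContDiffOn ℝ 3 z₂ Ω) (hz₃ : ContDiffOn ℝ 3 z₃ Ω)
    (hiso : ∀ p ∈ Ω, ∀ i j : Fin 2,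
      pd i z₁ p * pd j z₁ p + pd i z₂ p * pd j z₂ p + pd i z₃ p * pd j z₃ p
        = gmat g11 g12 g22 i j p) (m i j : Fin 2) {p : ℝ × ℝ} (hp : p ∈ Ω) :
    ∑ l : Fin 2, gmat g11 g12 g22 m l p * Chr g11 g12 g22 l i j p =
      pd i (pd j z₁) p * pd m z₁ p + pd i (pd j z₂) p * pd m z₂ p
        + pd i (pd j z₃) p * pd m z₃ p := by
  have hdiff {z : ℝ × ℝ → ℝ} (hz : ContDiffOn ℝ 3 z Ω) (k : Fin 2) :
      DifferentiableAt ℝ (pd k z) p :=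
    ((hz.pd_of_isOpen hΩ (m := 2) (by norm_num) k).contDiffAt
      (hΩ.mem_nhds hp)).differentiableAt (by norm_num)
  have hcomm {z : ℝ × ℝ → ℝ} (hz : ContDiffOn ℝ 3 z Ω) (k l : Fin 2) :
      pd k (pd l z) p = pd l (pd k z) p :=
    pd_comm ((hz.contDiffAt (hΩ.mem_nhds hp)).of_le (by norm_num)) k l
  have hpd (k i j : Fin 2) := (pd_congr_of_isOpen hΩ (fun q hq => (hiso q hq i j).symm) k hp).trans
    (pd_dot (hdiff hz₁ i) (hdiff hz₂ i) (hdiff hz₃ i) (hdiff hz₁ j) (hdiff hz₂ j) (hdiff hz₃ j) k)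
  rw [sum_gmat_mul_Chr (hd p hp), hpd, hpd, hpd, hcomm hz₁ m i, hcomm hz₂ m i, hcomm hz₃ m i,
    hcomm hz₁ m j, hcomm hz₂ m j, hcomm hz₃ m j, hcomm hz₁ j i, hcomm hz₂ j i, hcomm hz₃ j i]
  ring

theorem IsMetricOn.differentiableAt_gmat (hΩ : IsOpen Ω) (hg : IsMetricOn g11 g12 g22 Ω)
    {p : ℝ × ℝ} (hp : p ∈ Ω) (i j : Fin 2) : DifferentiableAt ℝ (gmat g11 g12 g22 i j) p := by
  have hdiff {f : ℝ × ℝ → ℝ} (hf : ContDiffOn ℝ (⊤ : ℕ∞) f Ω) : DifferentiableAt ℝ f p :=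
    (hf.contDiffAt (hΩ.mem_nhds hp)).differentiableAt (by simp)
  unfold gmat
  split_ifs
  exacts [hdiff hg.1, hdiff hg.2.1, hdiff hg.2.1, hdiff hg.2.2.1]

theorem IsMetricOn.differentiableAt_Chr (hΩ : IsOpen Ω) (hg : IsMetricOn g11 g12 g22 Ω)
    {p : ℝ × ℝ} (hp : p ∈ Ω) (l i j : Fin 2) :
    DifferentiableAt ℝ (Chr g11 g12 g22 l i j) p := by
  have hC (i j : Fin 2) : ContDiffOn ℝ (⊤ : ℕ∞) (gmat g11 g12 g22 i j) Ω := by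
    unfold gmat
    split_ifs
    exacts [hg.1, hg.2.1, hg.2.1, hg.2.2.1]
  have hpd (k i j : Fin 2) : DifferentiableAt ℝ (pd k (gmat g11 g12 g22 i j)) p :=
    (((hC i j).pd_of_isOpen hΩ (m := 1) (by norm_cast) k).contDiffAt
      (hΩ.mem_nhds hp)).differentiableAt (by norm_num)
  have h11 := hg.differentiableAt_gmat hΩ hp 0 0
  have h12 := hg.differentiableAt_gmat hΩ hp 0 1
  have h22 := hg.differentiableAt_gmat hΩ hp 1 1
  simp only [gmat, if_true, one_ne_zero, if_false] at h11 h12 h22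
  have hinv (i j : Fin 2) : DifferentiableAt ℝ (ginv g11 g12 g22 i j) p := by
    have hd : DifferentiableAt ℝ (gdet g11 g12 g22) p := (h11.mul h22).sub (h12.pow 2)
    have hne := (hg.2.2.2 p hp).2.ne'
    unfold ginv
    simp only [div_eq_mul_inv]
    split_ifs
    exacts [h22.mul (hd.inv hne), h12.neg.mul (hd.inv hne), h12.neg.mul (hd.inv hne),
      h11.mul (hd.inv hne)]
  unfold Chr
  simp only [Fin.sum_univ_two]
  exact (((hinv l 0).mul (((hpd i j 0).add (hpd j i 0)).sub (hpd 0 i j))).add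
    ((hinv l 1).mul (((hpd i j 1).add (hpd j i 1)).sub (hpd 1 i j)))).const_mul _

/-- Gauss's Theorema Egregium for an isometric embedding, in terms of the covariant second
derivatives of its components. -/
theorem GaussK_mul_gdet_of_isometric (hΩ : IsOpen Ω) (hg : IsMetricOn g11 g12 g22 Ω)
    (hz₁ : ContDiffOn ℝ 3 z₁ Ω) (hz₂ : ContDiffOn ℝ 3 z₂ Ω) (hz₃ : ContDiffOn ℝ 3 z₃ Ω)
    (hiso : ∀ p ∈ Ω, ∀ i j : Fin 2,
      pd i z₁ p * pd j z₁ p + pd i z₂ p * pd j z₂ p + pd i z₃ p * pd j z₃ p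
        = gmat g11 g12 g22 i j p) {p : ℝ × ℝ} (hp : p ∈ Ω) :
    GaussK g11 g12 g22 p * gdet g11 g12 g22 p =
      pd 0 (pd 0 z₁) p * cov2 g11 g12 g22 z₁ 1 1 p + pd 0 (pd 0 z₂) p * cov2 g11 g12 g22 z₂ 1 1 p
        + pd 0 (pd 0 z₃) p * cov2 g11 g12 g22 z₃ 1 1 p
        - (pd 0 (pd 1 z₁) p * cov2 g11 g12 g22 z₁ 0 1 p
          + pd 0 (pd 1 z₂) p * cov2 g11 g12 g22 z₂ 0 1 p
          + pd 0 (pd 1 z₃) p * cov2 g11 g12 g22 z₃ 0 1 p) := by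
  have hd : ∀ q ∈ Ω, gdet g11 g12 g22 q ≠ 0 := fun q hq => (hg.2.2.2 q hq).2.ne'
  have hlow (m i j : Fin 2) {q : ℝ × ℝ} (hq : q ∈ Ω) :=
    sum_gmat_mul_Chr_of_isometric hΩ hd hz₁ hz₂ hz₃ hiso m i j hq
  have hdiff {z : ℝ × ℝ → ℝ} (hz : ContDiffOn ℝ 3 z Ω) (k : Fin 2) :
      DifferentiableAt ℝ (pd k z) p :=
    ((hz.pd_of_isOpen hΩ (m := 2) (by norm_num) k).contDiffAt
      (hΩ.mem_nhds hp)).differentiableAt (by norm_num)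
  have hdiff2 {z : ℝ × ℝ → ℝ} (hz : ContDiffOn ℝ 3 z Ω) (k l : Fin 2) :
      DifferentiableAt ℝ (pd k (pd l z)) p :=
    (((hz.pd_of_isOpen hΩ (m := 2) (by norm_num) l).pd_of_isOpen hΩ (m := 1) (by norm_num)
      k).contDiffAt (hΩ.mem_nhds hp)).differentiableAt (by norm_num)
  have hcomm {z : ℝ × ℝ → ℝ} (hz : ContDiffOn ℝ 3 z Ω) :
      pd 1 (pd 0 z) p = pd 0 (pd 1 z) p :=
    pd_comm ((hz.contDiffAt (hΩ.mem_nhds hp)).of_le (by norm_num)) 1 0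
  have hcomm3 {z : ℝ × ℝ → ℝ} (hz : ContDiffOn ℝ 3 z Ω) :
      pd 1 (pd 0 (pd 1 z)) p = pd 0 (pd 1 (pd 1 z)) p :=
    pd_comm ((hz.pd_of_isOpen hΩ (m := 2) (by norm_num) 1).contDiffAt (hΩ.mem_nhds hp)) 1 0
  have hpd (k i j : Fin 2) := (pd_congr_of_isOpen hΩ (fun q hq => (hiso q hq i j).symm) k hp).trans
    (pd_dot (hdiff hz₁ i) (hdiff hz₂ i) (hdiff hz₃ i) (hdiff hz₁ j) (hdiff hz₂ j) (hdiff hz₃ j) k)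
  have hgd := hg.differentiableAt_gmat hΩ hp
  have hΓd := hg.differentiableAt_Chr hΩ hp
  have hder (k i j : Fin 2) := pd_congr_of_isOpen hΩ (fun q hq => hlow 0 i j hq) k hp
  simp only [Fin.sum_univ_two] at hder hlow
  simp only [pd_add ((hgd _ _).fun_mul (hΓd _ _ _)) ((hgd _ _).fun_mul (hΓd _ _ _)),
    pd_mul (hgd _ _) (hΓd _ _ _), hpd] at hder
  have e1 := hder 0 1 1
  have e2 := hder 1 0 1
  rw [pd_dot (hdiff2 hz₁ _ _) (hdiff2 hz₂ _ _) (hdiff2 hz₃ _ _) (hdiff hz₁ _) (hdiff hz₂ _)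
    (hdiff hz₃ _)] at e1 e2
  have l1 := hlow 0 0 0 hp
  have l2 := hlow 0 1 0 hp
  have l3 := hlow 0 0 1 hp
  have l4 := hlow 0 1 1 hp
  rw [hcomm3 hz₁, hcomm3 hz₂, hcomm3 hz₃] at e2
  rw [hcomm hz₁, hcomm hz₂, hcomm hz₃] at e2 l2
  rw [GaussK, one_div, mul_right_comm, inv_mul_cancel₀ (hd p hp), one_mul]
  simp only [cov2, Fin.sum_univ_two]
  linear_combination e1 - e2 + Chr g11 g12 g22 0 1 1 p * l1 + Chr g11 g12 g22 1 1 1 p * l2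
    - Chr g11 g12 g22 0 0 1 p * l3 - Chr g11 g12 g22 1 0 1 p * l4

/-- The first component of an isometric embedding satisfies Darboux's equation. -/
theorem darbouxEq_fst_of_isometric (hΩ : IsOpen Ω) (hg : IsMetricOn g11 g12 g22 Ω)
    (hz₁ : ContDiffOn ℝ 3 z₁ Ω) (hz₂ : ContDiffOn ℝ 3 z₂ Ω) (hz₃ : ContDiffOn ℝ 3 z₃ Ω)
    (hiso : ∀ p ∈ Ω, ∀ i j : Fin 2,
      pd i z₁ p * pd j z₁ p + pd i z₂ p * pd j z₂ p + pd i z₃ p * pd j z₃ p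
        = gmat g11 g12 g22 i j p) {p : ℝ × ℝ} (hp : p ∈ Ω) :
    DarbouxEq g11 g12 g22 z₁ p := by
  have hd : ∀ q ∈ Ω, gdet g11 g12 g22 q ≠ 0 := fun q hq => (hg.2.2.2 q hq).2.ne'
  have hcomm {z : ℝ × ℝ → ℝ} (hz : ContDiffOn ℝ 3 z Ω) :
      pd 1 (pd 0 z) p = pd 0 (pd 1 z) p :=
    pd_comm ((hz.contDiffAt (hΩ.mem_nhds hp)).of_le (by norm_num)) 1 0
  have horth (i j m : Fin 2) : cov2 g11 g12 g22 z₁ i j p * pd m z₁ p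
      + cov2 g11 g12 g22 z₂ i j p * pd m z₂ p + cov2 g11 g12 g22 z₃ i j p * pd m z₃ p = 0 := by
    have h := sum_gmat_mul_Chr_of_isometric hΩ hd hz₁ hz₂ hz₃ hiso m i j hp
    simp only [Fin.sum_univ_two, ← hiso p hp] at h
    simp only [cov2, Fin.sum_univ_two]
    linear_combination -h
  have hE : _ = g11 p := hiso p hp 0 0
  have hF : _ = g12 p := hiso p hp 0 1
  have hG : _ = g22 p := hiso p hp 1 1
  have key := det_fst_eq_of_orthogonal hE hF hG (hd p hp) (horth 0 0 0) (horth 0 0 1)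
    (horth 0 1 0) (horth 0 1 1) (horth 1 1 0) (horth 1 1 1)
  have hsymm : cov2 g11 g12 g22 z₁ 1 0 p = cov2 g11 g12 g22 z₁ 0 1 p := by
    have hgs : gmat g11 g12 g22 1 0 = gmat g11 g12 g22 0 1 := by simp [gmat]
    simp only [cov2, Chr, hcomm hz₁, Fin.sum_univ_two, hgs]
    ring
  have hgrad : gradSq g11 g12 g22 z₁ p = (g22 p * pd 0 z₁ p * pd 0 z₁ p
      - 2 * g12 p * pd 0 z₁ p * pd 1 z₁ p + g11 p * pd 1 z₁ p * pd 1 z₁ p) /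
        (g11 p * g22 p - g12 p ^ 2) := by
    simp only [gradSq, ginv, gdet, Fin.sum_univ_two, if_true, one_ne_zero, if_false]
    ring
  rw [DarbouxEq, hsymm, key, ← hgrad,
    GaussK_mul_gdet_of_isometric hΩ hg hz₁ hz₂ hz₃ hiso hp]
  congr 1
  have hU := fun m => horth 1 1 m
  have hV := fun m => horth 0 1 m
  have hexp {z : ℝ × ℝ → ℝ} (i j : Fin 2) : pd i (pd j z) p = cov2 g11 g12 g22 z i j p +
      (Chr g11 g12 g22 0 i j p * pd 0 z p + Chr g11 g12 g22 1 i j p * pd 1 z p) := by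
    simp only [cov2, Fin.sum_univ_two]
    ring
  rw [hexp, hexp, hexp, hexp, hexp, hexp]
  linear_combination -Chr g11 g12 g22 0 0 0 p * hU 0 - Chr g11 g12 g22 1 0 0 p * hU 1
    + Chr g11 g12 g22 0 0 1 p * hV 0 + Chr g11 g12 g22 1 0 1 p * hV 1

end Embedding

theorem embedding_components_satisfy_darboux
    (Ω : Set (ℝ × ℝ)) (hΩ : IsOpen Ω)
    (g11 g12 g22 : ℝ × ℝ → ℝ) (hg : IsMetricOn g11 g12 g22 Ω)
    (z₁ z₂ z₃ : ℝ × ℝ → ℝ)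
    (hz₁ : ContDiffOn ℝ 3 z₁ Ω) (hz₂ : ContDiffOn ℝ 3 z₂ Ω) (hz₃ : ContDiffOn ℝ 3 z₃ Ω)
    (hiso : ∀ p ∈ Ω, ∀ i j : Fin 2,
      pd i z₁ p * pd j z₁ p + pd i z₂ p * pd j z₂ p + pd i z₃ p * pd j z₃ p
        = gmat g11 g12 g22 i j p) :
    ∀ p ∈ Ω, DarbouxEq g11 g12 g22 z₁ p ∧ DarbouxEq g11 g12 g22 z₂ p ∧
      DarbouxEq g11 g12 g22 z₃ p := by
  intro p hp
  refine ⟨darbouxEq_fst_of_isometric hΩ hg hz₁ hz₂ hz₃ hiso hp,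
    darbouxEq_fst_of_isometric hΩ hg hz₂ hz₁ hz₃ (fun q hq i j => ?_) hp,
    darbouxEq_fst_of_isometric hΩ hg hz₃ hz₁ hz₂ (fun q hq i j => ?_) hp⟩
  all_goals
    rw [← hiso q hq i j]
    ring

end
end

section
/- Let p = (p¹, p²) ∈ ℝ², let a and b be C³ real-valued functions on an open neighborhood of p with a(p) ≠ 0, and let c ∈ ℝ. Then there exist an open neighborhood U of p and a function s ∈ C³(U) such that a·∂s/∂x + b·∂s/∂y = 0 on U and s(p¹, y) = c·y for every y with (p¹, y) ∈ U; moreover s is locally unique: any C¹ function satisfying these two conditions on a neighborhood of p agrees with s on some neighborhood of p. -/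
open Real Set Filter Topology

noncomputable section

theorem ContinuousMap.hasFDerivAt_postcomp {K E F : Type*} [TopologicalSpace K] [CompactSpace K]
    [NormedAddCommGroup E] [NormedSpace ℝ E] [NormedAddCommGroup F] [NormedSpace ℝ F]
    (f : C(E, F)) (f' : C(E, E →L[ℝ] F)) (h : ∀ x, HasFDerivAt f (f' x) x)
    (L : C(K, E →L[ℝ] F) →L[ℝ] C(K, E) →L[ℝ] C(K, F)) (hL : ∀ A v t, L A v t = A t (v t))
    (u : C(K, E)) :
    HasFDerivAt (fun v : C(K, E) => f.comp v) (L (f'.comp u)) u := by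
  rw [hasFDerivAt_iff_isLittleO_nhds_zero, Asymptotics.isLittleO_iff]
  intro ε hε
  have hc : ContinuousAt (fun v : C(K, E) => f'.comp v) u :=
    (ContinuousMap.continuous_postcomp f').continuousAt
  obtain ⟨δ, hδ, H⟩ := (Metric.continuousAt_iff (α := C(K, E)) (β := C(K, E →L[ℝ] F))).1 hc ε hε
  filter_upwards [Metric.ball_mem_nhds (0 : C(K, E)) hδ] with w hw
  have hw' : ‖w‖ < δ := by simpa using hw
  rw [ContinuousMap.norm_le _ (by positivity)]
  intro t
  have key := (convex_segment (0 : ℝ) 1).norm_image_sub_le_of_norm_hasFDerivWithin_le'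
    (𝕜 := ℝ) (f := fun θ : ℝ => f (u t + θ • w t))
    (f' := fun θ => (f' (u t + θ • w t)).comp (ContinuousLinearMap.toSpanSingleton ℝ (w t)))
    (φ := (f' (u t)).comp (ContinuousLinearMap.toSpanSingleton ℝ (w t)))
    (C := ε * ‖w‖) (x := 0) (y := 1) ?_ ?_
    (left_mem_segment ..) (right_mem_segment ..)
  · simpa [hL] using key
  · intro θ _
    have h1 : HasFDerivAt (fun θ : ℝ => u t + θ • w t)
        (ContinuousLinearMap.toSpanSingleton ℝ (w t)) θ := by
      simpa using ((ContinuousLinearMap.toSpanSingleton ℝ (w t)).hasFDerivAt (x := θ)).const_add (u t)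
    exact ((h _).comp θ h1).hasFDerivWithinAt
  · intro θ hθ
    rw [segment_eq_Icc zero_le_one] at hθ
    have h1 : dist (u + θ • w) u < δ := by
      rw [dist_eq_norm, add_sub_cancel_left, norm_smul, Real.norm_of_nonneg hθ.1]
      exact (mul_le_of_le_one_left (norm_nonneg _) hθ.2).trans_lt hw'
    have h2 : ‖f' (u t + θ • w t) - f' (u t)‖ ≤ ε := by
      have := (ContinuousMap.dist_apply_le_dist (f := f'.comp (u + θ • w)) (g := f'.comp u) t).trans
        (H h1).le
      simpa [dist_eq_norm] using this
    rw [← ContinuousLinearMap.sub_comp]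
    refine (ContinuousLinearMap.opNorm_comp_le _ _).trans ?_
    rw [ContinuousLinearMap.norm_toSpanSingleton]
    gcongr
    exact w.norm_coe_le_norm t

/-- Pointwise application of a continuous family of operators to a continuous family of vectors. -/
def ContinuousMap.clmApplyL (K E F : Type*) [TopologicalSpace K] [CompactSpace K]
    [NormedAddCommGroup E] [NormedSpace ℝ E] [NormedAddCommGroup F] [NormedSpace ℝ F] :
    C(K, E →L[ℝ] F) →L[ℝ] C(K, E) →L[ℝ] C(K, F) :=
  LinearMap.mkContinuous₂
    (LinearMap.mk₂ ℝ (fun (A : C(K, E →L[ℝ] F)) (v : C(K, E)) =>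
        (⟨fun t => A t (v t), by fun_prop⟩ : C(K, F)))
      (by intros; ext; simp) (by intros; ext; simp) (by intros; ext; simp) (by intros; ext; simp))
    1 (by
      intro A v
      rw [one_mul, ContinuousMap.norm_le _ (by positivity)]
      intro t
      exact ((A t).le_opNorm _).trans (mul_le_mul (A.norm_coe_le_norm t) (v.norm_coe_le_norm t)
        (norm_nonneg _) (by positivity)))

/-- Superposition by a `C^n` map is a `C^n` operator on continuous functions. -/
theorem ContinuousMap.contDiff_postcomp.{u} {K : Type*} [TopologicalSpace K] [CompactSpace K]
    {E : Type u} [NormedAddCommGroup E] [NormedSpace ℝ E] (n : ℕ) :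
    ∀ {F : Type u} [NormedAddCommGroup F] [NormedSpace ℝ F] (f : C(E, F)), ContDiff ℝ n f →
      ContDiff ℝ n (fun v : C(K, E) => f.comp v) := by
  induction n with
  | zero =>
    intro F _ _ f _
    exact contDiff_zero.2 (ContinuousMap.continuous_postcomp f)
  | succ n ih =>
    intro F _ _ f hf
    have hf' : ContDiff ℝ n (fderiv ℝ f) := hf.fderiv_right le_rfl
    let f' : C(E, E →L[ℝ] F) := ⟨fderiv ℝ f, hf'.continuous⟩
    refine contDiff_succ_iff_hasFDerivAt.2
      ⟨fun u => ContinuousMap.clmApplyL K E F (f'.comp u), ?_, fun u => ?_⟩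
    · exact (ContinuousMap.clmApplyL K E F).contDiff.comp (ih f' hf')
    · exact f.hasFDerivAt_postcomp f'
        (fun x => (hf.differentiable (by simp) x).hasFDerivAt) _ (fun _ _ _ => rfl) u

/-- Integration from `0` of continuous functions on `[-1, 1]`. -/
def ContinuousMap.primitiveL (E : Type*) [NormedAddCommGroup E] [NormedSpace ℝ E] :
    C(Icc (-1 : ℝ) 1, E) →L[ℝ] C(Icc (-1 : ℝ) 1, E) :=
  LinearMap.mkContinuous
    { toFun := fun u => ⟨fun t => ∫ r in (0 : ℝ)..t, IccExtend (by norm_num) u r, by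
        have : Continuous (IccExtend (by norm_num) u : ℝ → E) := u.continuous.Icc_extend'
        exact (intervalIntegral.continuous_primitive
          (fun a b => this.intervalIntegrable a b) 0).comp continuous_subtype_val⟩
      map_add' := by
        intro u v
        ext t
        have h (u : C(Icc (-1 : ℝ) 1, E)) : Continuous (IccExtend (by norm_num) u : ℝ → E) :=
          u.continuous.Icc_extend'
        exact intervalIntegral.integral_add ((h u).intervalIntegrable _ _)
          ((h v).intervalIntegrable _ _)
      map_smul' := by
        intro c u
        ext t
        exact intervalIntegral.integral_smul c _ }
    1 (by
      intro u
      rw [one_mul, ContinuousMap.norm_le _ (norm_nonneg _)]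
      intro t
      refine (intervalIntegral.norm_integral_le_of_norm_le_const (C := ‖u‖)
        (fun r _ => u.norm_coe_le_norm _)).trans ?_
      refine mul_le_of_le_one_right (norm_nonneg _) ?_
      rw [sub_zero]
      exact abs_le.2 t.2)

theorem ContinuousMap.primitiveL_apply {E : Type*} [NormedAddCommGroup E] [NormedSpace ℝ E]
    (u : C(Icc (-1 : ℝ) 1, E)) (t : Icc (-1 : ℝ) 1) :
    primitiveL E u t = ∫ r in (0 : ℝ)..t, IccExtend (by norm_num) u r := rfl

/-- A `C^n` vector field on a Banach space has a local flow which is jointly `C^n`. -/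
theorem exists_contDiffAt_flow {E : Type*} [NormedAddCommGroup E] [NormedSpace ℝ E]
    [CompleteSpace E] {n : ℕ} (hn : n ≠ 0) (X : E → E) (hX : ContDiff ℝ n X) (z₀ : E) :
    ∃ φ : ℝ × E → E, ContDiffAt ℝ n φ (0, z₀) ∧ ∃ δ > 0, ∀ z, dist z z₀ < δ →
      φ (0, z) = z ∧ ∀ t, |t| < δ → HasDerivAt (fun τ => φ (τ, z)) (X (φ (t, z))) t := by
  let X' : C(E, E) := ⟨X, hX.continuous⟩
  let cst : E →L[ℝ] C(Icc (-1 : ℝ) 1, E) := ContinuousLinearMap.const ℝ (Icc (-1 : ℝ) 1)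
  let G : (ℝ × E) × C(Icc (-1 : ℝ) 1, E) → C(Icc (-1 : ℝ) 1, E) := fun q =>
    q.2 - cst q.1.2 - q.1.1 • ContinuousMap.primitiveL E (X'.comp q.2)
  have hG : ContDiff ℝ n G := by
    have h1 := (ContinuousMap.contDiff_postcomp (K := Icc (-1 : ℝ) 1) n X' hX).comp
      (contDiff_snd (E := ℝ × E) (F := C(Icc (-1 : ℝ) 1, E)))
    have h2 := (ContinuousMap.primitiveL E).contDiff.comp h1
    have h3 := cst.contDiff (n := n)
    refine (contDiff_snd.sub (h3.comp (contDiff_snd.comp contDiff_fst))).sub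
      (ContDiff.smul (contDiff_fst.comp contDiff_fst) h2)
  let q₀ : (ℝ × E) × C(Icc (-1 : ℝ) 1, E) := ((0, z₀), cst z₀)
  have hGa : ContDiffAt ℝ n G q₀ := hG.contDiffAt
  have hn' : (n : WithTop ℕ∞) ≠ 0 := by exact_mod_cast hn
  have hinv : (fderiv ℝ G q₀ ∘L .inr ℝ (ℝ × E) C(Icc (-1 : ℝ) 1, E)).IsInvertible := by
    have h1 : HasFDerivAt (fun u => G ((0, z₀), u))
        (fderiv ℝ G q₀ ∘L .inr ℝ (ℝ × E) C(Icc (-1 : ℝ) 1, E)) (cst z₀) :=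
      HasFDerivAt.comp (cst z₀) (hGa.differentiableAt hn').hasFDerivAt (hasFDerivAt_prodMk_right _ _)
    have h2 : (fun u => G ((0, z₀), u)) = fun u => u - cst z₀ := by
      ext u; simp [G]
    rw [h2] at h1
    rw [h1.unique ((hasFDerivAt_id _).sub_const _)]
    exact ⟨ContinuousLinearEquiv.refl ℝ _, rfl⟩
  let ψ := hGa.implicitFunction hn' hinv
  have hψ : ContDiffAt ℝ n ψ (0, z₀) := hGa.contDiffAt_implicitFunction hn' hinv
  have hψ0 : ψ (0, z₀) = cst z₀ := hGa.implicitFunction_apply_self hn' hinv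
  have hG0 : G q₀ = 0 := by simp [G, q₀]
  obtain ⟨r, hr, Hr⟩ := Metric.eventually_nhds_iff.1
    (hGa.eventually_apply_eq_iff_implicitFunction hn' hinv)
  have hcont : ∀ᶠ w in 𝓝 ((0 : ℝ), z₀), dist (ψ w) (cst z₀) < r := by
    have := hψ.continuousAt
    rw [ContinuousAt, hψ0] at this
    exact this.eventually (Metric.ball_mem_nhds _ hr)
  obtain ⟨η, hη, Hη⟩ := Metric.eventually_nhds_iff.1 hcont
  let ε := min r η / 2
  have hε : 0 < ε := half_pos (lt_min hr hη)
  have hεr : ε < r := (half_lt_self (lt_min hr hη)).trans_le (min_le_left _ _)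
  have hεη : ε < η := (half_lt_self (lt_min hr hη)).trans_le (min_le_right _ _)
  refine ⟨fun w => ψ w ⟨1, by norm_num⟩,
    (ContinuousMap.evalCLM (M := E) ℝ (⟨1, by norm_num⟩ : Icc (-1 : ℝ) 1)).contDiff.contDiffAt.comp
      ((0 : ℝ), z₀) hψ,
    ε, hε, fun z hz => ?_⟩
  have hd : ∀ t : Icc (-1 : ℝ) 1, dist (ε * (t : ℝ), z) ((0 : ℝ), z₀) ≤ ε := fun t => by
    rw [Prod.dist_eq, max_le_iff]
    refine ⟨?_, hz.le⟩
    rw [Real.dist_eq, sub_zero, abs_mul, abs_of_pos hε]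
    exact mul_le_of_le_one_right hε.le (abs_le.2 t.2)
  set U := ψ (ε, z) with hU
  have hUr : dist U (cst z₀) < r := Hη ((by simpa using hd ⟨1, by norm_num⟩ : _ ≤ ε).trans_lt hεη)
  let V : ℝ → E := IccExtend (by norm_num : (-1 : ℝ) ≤ 1) U
  have hV : Continuous V := U.continuous.Icc_extend'
  have hVU : ∀ t : Icc (-1 : ℝ) 1, V t = U t := fun t => IccExtend_val _ _ t
  have hUeq : ∀ t : Icc (-1 : ℝ) 1, V t = z + ε • ∫ τ in (0 : ℝ)..t, X (V τ) := by
    intro t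
    have h1 : G ((ε, z), U) = 0 := by
      rw [← hG0]
      refine (Hr (y := ((ε, z), U)) ?_).2 rfl
      rw [Prod.dist_eq]
      exact max_lt ((by simpa using hd ⟨1, by norm_num⟩ : _ ≤ ε).trans_lt hεr) hUr
    have h2 := DFunLike.congr_fun h1 t
    have h3 : U t - z - ε • (∫ τ in (0 : ℝ)..t, X (V τ)) = 0 := h2
    rw [hVU, ← sub_eq_zero, ← h3]
    abel
  have hscale : ∀ t : Icc (-1 : ℝ) 1, ψ (ε * t, z) ⟨1, by norm_num⟩ = V t := by
    intro t
    have hmem : ∀ s : Icc (-1 : ℝ) 1, (t : ℝ) * s ∈ Icc (-1 : ℝ) 1 := fun s => by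
      rw [mem_Icc, ← abs_le, abs_mul]
      exact mul_le_one₀ (abs_le.2 t.2) (abs_nonneg _) (abs_le.2 s.2)
    let v : C(Icc (-1 : ℝ) 1, E) := ⟨fun s => V (t * s), by fun_prop⟩
    have hv : ∀ s, v s = U ⟨t * s, hmem s⟩ := fun s => hVU ⟨t * s, hmem s⟩
    have h1 : G ((ε * t, z), v) = 0 := by
      ext s
      change v s - z - (ε * (t : ℝ)) • (∫ τ in (0 : ℝ)..s,
        X (IccExtend (by norm_num : (-1 : ℝ) ≤ 1) v τ)) = 0
      have h2 : (∫ τ in (0 : ℝ)..s, X (IccExtend (by norm_num : (-1 : ℝ) ≤ 1) v τ))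
          = ∫ τ in (0 : ℝ)..s, X (V (t * τ)) := by
        refine intervalIntegral.integral_congr fun τ hτ => ?_
        have hτ' : τ ∈ Icc (-1 : ℝ) 1 :=
          uIcc_subset_Icc (by norm_num : (0 : ℝ) ∈ Icc (-1 : ℝ) 1) s.2 hτ
        simp only [IccExtend_of_mem _ _ hτ']
        rfl
      rw [h2, mul_smul, intervalIntegral.smul_integral_comp_mul_left (fun τ => X (V τ)), mul_zero]
      have h3 := hUeq ⟨t * s, hmem s⟩
      change V (t * s) - z - _ = 0
      rw [sub_sub, sub_eq_zero]
      exact h3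
    have h2 : ψ (ε * t, z) = v := by
      refine (Hr (y := ((ε * t, z), v)) ?_).1 (h1.trans hG0.symm)
      rw [Prod.dist_eq]
      refine max_lt ((hd t).trans_lt hεr) ?_
      refine (ContinuousMap.dist_lt_iff hr).2 fun s => ?_
      rw [hv]
      exact (ContinuousMap.dist_apply_le_dist (f := U) (g := cst z₀) ⟨t * s, hmem s⟩).trans_lt hUr
    rw [h2]
    change V (t * 1) = V t
    rw [mul_one]
  have hφ : ∀ τ, |τ| < ε → ψ (τ, z) ⟨1, by norm_num⟩ =
      z + ε • ∫ x in (0 : ℝ)..(ε⁻¹ * τ), X (V x) := by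
    intro τ hτ
    have hm : ε⁻¹ * τ ∈ Icc (-1 : ℝ) 1 := by
      rw [mem_Icc, ← abs_le, abs_mul, abs_of_pos (inv_pos.2 hε), inv_mul_le_iff₀ hε, mul_one]
      exact hτ.le
    have h1 := hscale ⟨ε⁻¹ * τ, hm⟩
    rw [hUeq ⟨ε⁻¹ * τ, hm⟩] at h1
    simpa [mul_inv_cancel_left₀ hε.ne'] using h1
  refine ⟨by simpa using hφ 0 (by simpa using hε), fun t ht => ?_⟩
  have hm : ε⁻¹ * t ∈ Icc (-1 : ℝ) 1 := by
    rw [mem_Icc, ← abs_le, abs_mul, abs_of_pos (inv_pos.2 hε), inv_mul_le_iff₀ hε, mul_one]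
    exact ht.le
  have h1 : ψ (t, z) ⟨1, by norm_num⟩ = V (ε⁻¹ * t) := by
    simpa [mul_inv_cancel_left₀ hε.ne'] using hscale ⟨ε⁻¹ * t, hm⟩
  have h2 : HasDerivAt (fun τ => z + ε • ∫ x in (0 : ℝ)..(ε⁻¹ * τ), X (V x))
      (X (V (ε⁻¹ * t))) t := by
    have hc : Continuous fun x => X (V x) := hX.continuous.comp hV
    have h3 := (hc.integral_hasStrictDerivAt 0 (ε⁻¹ * t)).hasDerivAt
    have h4 : HasDerivAt (fun τ : ℝ => ε⁻¹ * τ) ε⁻¹ t := by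
      simpa using (hasDerivAt_id t).const_mul ε⁻¹
    have h5 := ((h3.scomp t h4).const_smul ε).const_add z
    rwa [smul_inv_smul₀ hε.ne'] at h5
  simp only [h1]
  refine h2.congr_of_eventuallyEq ?_
  filter_upwards [(isOpen_lt continuous_abs continuous_const).mem_nhds ht] with τ hτ
  exact hφ τ hτ

theorem exists_contDiff_eventuallyEq {E F : Type*} [NormedAddCommGroup E] [NormedSpace ℝ E]
    [FiniteDimensional ℝ E] [NormedAddCommGroup F] [NormedSpace ℝ F] {n : ℕ∞} {g : E → F}
    {V : Set E} {p : E} (hV : IsOpen V) (hp : p ∈ V) (hg : ContDiffOn ℝ n g V) :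
    ∃ h : E → F, ContDiff ℝ n h ∧ h =ᶠ[𝓝 p] g := by
  obtain ⟨r, hr, hrV⟩ := Metric.isOpen_iff.1 hV p hp
  let ρ : ContDiffBump p := ⟨r / 4, r / 2, by positivity, by linarith⟩
  refine ⟨fun x => ρ x • g x, contDiff_iff_contDiffAt.2 fun x => ?_, ?_⟩
  · by_cases hx : x ∈ V
    · exact ρ.contDiff.contDiffAt.smul (hg.contDiffAt (hV.mem_nhds hx))
    · have hx' : x ∉ tsupport ρ := fun h => by
        rw [ρ.tsupport_eq] at h
        exact hx (hrV (Metric.closedBall_subset_ball (half_lt_self hr) h))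
      refine contDiffAt_const (c := (0 : F)) |>.congr_of_eventuallyEq ?_
      filter_upwards [notMem_tsupport_iff_eventuallyEq.1 hx'] with y hy
      simp [hy]
  · filter_upwards [ρ.eventuallyEq_one] with x hx
    simp [hx]

theorem fderiv_apply_eq_pd (g : ℝ × ℝ → ℝ) (q : ℝ × ℝ) (u v : ℝ) :
    fderiv ℝ g q (u, v) = u * pd 0 g q + v * pd 1 g q := by
  have h : ((u, v) : ℝ × ℝ) = u • (1, 0) + v • (0, 1) := by simp
  rw [h, map_add, map_smul, map_smul]
  simp [pd]

/-- A linear endomorphism of the plane sending the standard basis to `(u, v)` and `(0, 1)` with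
`u ≠ 0` is invertible. -/
theorem exists_equiv_of_lower_triangular (D : ℝ × ℝ →L[ℝ] ℝ × ℝ) {u v : ℝ} (hu : u ≠ 0)
    (h1 : D (1, 0) = (u, v)) (h2 : D (0, 1) = (0, 1)) :
    ∃ e : (ℝ × ℝ) ≃L[ℝ] ℝ × ℝ, (e : ℝ × ℝ →L[ℝ] ℝ × ℝ) = D := by
  have hD : ∀ w : ℝ × ℝ, D w = (w.1 * u, w.1 * v + w.2) := fun w => by
    have h : w = w.1 • (1, 0) + w.2 • (0, 1) := by simp
    conv_lhs => rw [h, map_add, map_smul, map_smul, h1, h2]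
    simp
  have hinj : Function.Injective (D : ℝ × ℝ →ₗ[ℝ] ℝ × ℝ) := by
    rw [injective_iff_map_eq_zero]
    intro w hw
    have hw' : (w.1 * u, w.1 * v + w.2) = (0 : ℝ × ℝ) := (hD w).symm.trans hw
    have h3 : w.1 = 0 := by simpa [hu] using congrArg Prod.fst hw'
    have h4 : w.2 = 0 := by simpa [h3] using congrArg Prod.snd hw'
    exact Prod.ext h3 h4
  exact ⟨(LinearEquiv.ofInjectiveEndo _ hinj).toContinuousLinearEquiv, by ext <;> rfl⟩

theorem first_order_noncharacteristic_solvability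
    (p : ℝ × ℝ) (a b : ℝ × ℝ → ℝ) (V : Set (ℝ × ℝ)) (hV : IsOpen V) (hpV : p ∈ V)
    (ha : ContDiffOn ℝ 3 a V) (hb : ContDiffOn ℝ 3 b V)
    (hap : a p ≠ 0) (c : ℝ) :
    ∃ (U : Set (ℝ × ℝ)) (s : ℝ × ℝ → ℝ),
      IsOpen U ∧ p ∈ U ∧ U ⊆ V ∧
      ContDiffOn ℝ 3 s U ∧
      (∀ q ∈ U, a q * pd 0 s q + b q * pd 1 s q = 0) ∧
      (∀ y : ℝ, (p.1, y) ∈ U → s (p.1, y) = c * y) ∧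
      (∀ (s' : ℝ × ℝ → ℝ) (U' : Set (ℝ × ℝ)), IsOpen U' → p ∈ U' →
        ContDiffOn ℝ 1 s' U' →
        (∀ q ∈ U', a q * pd 0 s' q + b q * pd 1 s' q = 0) →
        (∀ y : ℝ, (p.1, y) ∈ U' → s' (p.1, y) = c * y) →
        ∃ W : Set (ℝ × ℝ), IsOpen W ∧ p ∈ W ∧ ∀ q ∈ W, s' q = s q) := by
  obtain ⟨a', ha', haa⟩ := exists_contDiff_eventuallyEq (n := 3) hV hpV ha
  obtain ⟨b', hb', hbb⟩ := exists_contDiff_eventuallyEq (n := 3) hV hpV hb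
  obtain ⟨φ, hφ, δ, hδ, H⟩ := exists_contDiffAt_flow (n := 3) (by norm_num)
    (fun q => (a' q, b' q)) (ha'.prodMk hb') p
  let Φ : ℝ × ℝ → ℝ × ℝ := fun w => φ (w.1, (p.1, w.2))
  let q₀ : ℝ × ℝ := (0, p.2)
  have hΦ : ContDiffAt ℝ 3 Φ q₀ :=
    ContDiffAt.comp q₀ (g := φ) (f := fun w : ℝ × ℝ => (w.1, (p.1, w.2))) hφ (by fun_prop)
  have hdist : ∀ y, dist y p.2 < δ → dist (p.1, y) p < δ := fun y hy => by
    rw [Prod.dist_eq]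
    exact max_lt (by simpa using hδ) hy
  have hΦ0 : ∀ y, dist y p.2 < δ → Φ (0, y) = (p.1, y) := fun y hy => (H _ (hdist y hy)).1
  have hΦd : ∀ t y, |t| < δ → dist y p.2 < δ →
      HasDerivAt (fun τ => Φ (τ, y)) (a' (Φ (t, y)), b' (Φ (t, y))) t :=
    fun t y ht hy => (H _ (hdist y hy)).2 t ht
  have hp2 : dist p.2 p.2 < δ := by simpa using hδ
  have hΦp : Φ q₀ = p := hΦ0 p.2 hp2
  have hD := (hΦ.differentiableAt (by norm_num)).hasFDerivAt
  have hD1 : fderiv ℝ Φ q₀ (1, 0) = (a p, b p) := by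
    have h1 : HasDerivAt (fun τ : ℝ => (τ, p.2)) (1, 0) 0 :=
      (hasDerivAt_id 0).prodMk (hasDerivAt_const _ _)
    have h2 := (HasFDerivAt.comp_hasDerivAt (l := Φ) (f := fun τ : ℝ => (τ, p.2)) (0 : ℝ) hD h1).unique
      (hΦd 0 p.2 (by simpa using hδ) hp2)
    rwa [show Φ (0, p.2) = p from hΦp, haa.self_of_nhds, hbb.self_of_nhds] at h2
  have hD2 : fderiv ℝ Φ q₀ (0, 1) = (0, 1) := by
    have h1 : HasDerivAt (fun y : ℝ => ((0 : ℝ), y)) (0, 1) p.2 :=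
      (hasDerivAt_const _ _).prodMk (hasDerivAt_id _)
    have h2 : HasDerivAt (fun y : ℝ => (p.1, y)) (0, 1) p.2 :=
      (hasDerivAt_const _ _).prodMk (hasDerivAt_id _)
    refine (hD.comp_hasDerivAt p.2 h1).unique (h2.congr_of_eventuallyEq ?_)
    filter_upwards [Metric.ball_mem_nhds p.2 hδ] with y hy
    exact hΦ0 y hy
  obtain ⟨D, hDe⟩ := exists_equiv_of_lower_triangular _ hap hD1 hD2
  rw [← hDe] at hD
  let e := hΦ.toOpenPartialHomeomorph Φ hD (by norm_num)
  have hsymm : ContDiffAt ℝ 3 e.symm p := by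
    have := hΦ.to_localInverse hD (by norm_num)
    rwa [hΦp] at this
  have htend : Tendsto Φ (𝓝 q₀) (𝓝 p) := by simpa [ContinuousAt, hΦp] using hΦ.continuousAt
  have hev : ∀ᶠ w in 𝓝 q₀, w ∈ e.source ∧ Φ w ∈ V ∧ a' (Φ w) = a (Φ w) ∧ b' (Φ w) = b (Φ w) ∧
      ContDiffAt ℝ 3 e.symm (Φ w) := by
    filter_upwards [e.open_source.mem_nhds (hΦ.mem_toOpenPartialHomeomorph_source hD (by norm_num)),
      htend.eventually (hV.mem_nhds hpV), htend.eventually haa, htend.eventually hbb,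
      htend.eventually (hsymm.eventually (by simp))] with w h1 h2 h3 h4 h5
    exact ⟨h1, h2, h3, h4, h5⟩
  obtain ⟨η₀, hη₀, Hη₀⟩ := Metric.eventually_nhds_iff.1 hev
  obtain ⟨η, hη, hηδ, hηη₀⟩ : ∃ η > 0, η ≤ δ ∧ η ≤ η₀ :=
    ⟨min δ η₀, lt_min hδ hη₀, min_le_left _ _, min_le_right _ _⟩
  have hball : ∀ {r t y : ℝ}, (t, y) ∈ Metric.ball q₀ r ↔ |t| < r ∧ dist y p.2 < r := by
    intro r t y
    rw [Metric.mem_ball, Prod.dist_eq, max_lt_iff, Real.dist_eq, sub_zero]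
  have hsub : Metric.ball q₀ η ⊆ e.source := fun w hw => (Hη₀ (hw.trans_le hηη₀)).1
  have hopen : ∀ r ≤ η, IsOpen (Φ '' Metric.ball q₀ r) := fun r hr =>
    e.isOpen_image_of_subset_source Metric.isOpen_ball
      ((Metric.ball_subset_ball hr).trans hsub)
  have hinv : ∀ w ∈ Metric.ball q₀ η, e.symm (Φ w) = w := fun w hw => e.left_inv (hsub hw)
  have hchain : ∀ (g : ℝ × ℝ → ℝ) (t y : ℝ), (t, y) ∈ Metric.ball q₀ η →
      DifferentiableAt ℝ g (Φ (t, y)) → HasDerivAt (fun τ => g (Φ (τ, y)))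
        (a (Φ (t, y)) * pd 0 g (Φ (t, y)) + b (Φ (t, y)) * pd 1 g (Φ (t, y))) t := by
    intro g t y hw hg
    obtain ⟨-, -, h3, h4, -⟩ := Hη₀ (hw.trans_le hηη₀)
    have h5 := hΦd t y ((hball.1 hw).1.trans_le hηδ) ((hball.1 hw).2.trans_le hηδ)
    rw [h3, h4] at h5
    rw [← fderiv_apply_eq_pd]
    exact hg.hasFDerivAt.comp_hasDerivAt t h5
  have hsd : ∀ w ∈ Metric.ball q₀ η, ContDiffAt ℝ 3 (fun q => c * (e.symm q).2) (Φ w) := by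
    intro w hw
    exact contDiffAt_const.mul (contDiffAt_snd.comp _ (Hη₀ (hw.trans_le hηη₀)).2.2.2.2)
  refine ⟨Φ '' Metric.ball q₀ η ∩ {q | dist q.2 p.2 < η}, fun q => c * (e.symm q).2,
    (hopen η le_rfl).inter (isOpen_lt (by fun_prop) continuous_const),
    ⟨⟨q₀, Metric.mem_ball_self hη, hΦp⟩, by simpa using hη⟩, ?_, ?_, ?_, ?_, ?_⟩
  · rintro _ ⟨⟨w, hw, rfl⟩, -⟩
    exact (Hη₀ (hw.trans_le hηη₀)).2.1
  · rintro _ ⟨⟨w, hw, rfl⟩, -⟩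
    exact (hsd w hw).contDiffWithinAt
  · rintro _ ⟨⟨⟨t, y⟩, hw, rfl⟩, -⟩
    refine (hchain _ t y hw ((hsd _ hw).differentiableAt (by norm_num))).unique ?_
    refine (hasDerivAt_const t (c * y)).congr_of_eventuallyEq ?_
    filter_upwards [(isOpen_lt continuous_abs continuous_const).mem_nhds (hball.1 hw).1] with τ hτ
    rw [hinv _ (hball.2 ⟨hτ, (hball.1 hw).2⟩)]
  · rintro y ⟨-, hy⟩
    have h1 : e.symm (p.1, y) = (0, y) := by
      rw [← hΦ0 y (hy.trans_le hηδ)]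
      exact hinv _ (hball.2 ⟨by simpa using hη, hy⟩)
    simp only [h1]
  · intro s' U' hU' hpU' hs' hpde hinit
    obtain ⟨θ₀, hθ₀, Hθ₀⟩ := Metric.eventually_nhds_iff.1 (htend.eventually (hU'.mem_nhds hpU'))
    obtain ⟨θ, hθ, hθη, hθθ₀⟩ : ∃ θ > 0, θ ≤ η ∧ θ ≤ θ₀ :=
      ⟨min η θ₀, lt_min hη hθ₀, min_le_left _ _, min_le_right _ _⟩
    refine ⟨Φ '' Metric.ball q₀ θ, hopen θ hθη, ⟨q₀, Metric.mem_ball_self hθ, hΦp⟩, ?_⟩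
    rintro _ ⟨⟨t, y⟩, hw, rfl⟩
    obtain ⟨ht, hy⟩ := hball.1 hw
    have hU : ∀ τ, |τ| < θ → Φ (τ, y) ∈ U' := fun τ hτ =>
      Hθ₀ (Metric.mem_ball.1 (hball.2 ⟨hτ.trans_le hθθ₀, hy.trans_le hθθ₀⟩))
    have hd : ∀ τ ∈ Ioo (-θ) θ, HasDerivAt (fun τ => s' (Φ (τ, y))) 0 τ := by
      intro τ hτ
      have hτ' := abs_lt.2 hτ
      rw [← hpde _ (hU τ hτ')]
      exact hchain s' τ y (hball.2 ⟨hτ'.trans_le hθη, hy.trans_le hθη⟩)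
        ((hs'.contDiffAt (hU'.mem_nhds (hU τ hτ'))).differentiableAt (by norm_num))
    have hconst := isOpen_Ioo.is_const_of_deriv_eq_zero isPreconnected_Ioo
      (fun τ hτ => (hd τ hτ).differentiableAt.differentiableWithinAt) (fun τ hτ => (hd τ hτ).deriv)
      (abs_lt.1 ht) (⟨neg_lt_zero.2 hθ, hθ⟩ : (0 : ℝ) ∈ Ioo (-θ) θ)
    have h0 := hU 0 (by simpa using hθ)
    have h1 := hΦ0 y ((hy.trans_le hθη).trans_le hηδ)
    rw [h1] at h0
    simpa only [hinv _ (Metric.ball_subset_ball hθη hw), h1, hinit y h0] using hconst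

end
end
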